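/- Let K be a separable metric space, let f, g : K → ℝ be bounded functions in B_{1/2}(K), let ε > 0, and let h = max{f,g} or h = min{f,g}. Then i(h, ε) ≤ i(f, ε) + i(g, ε). -/

import Mathlib

open Filter Topology Set

noncomputable section

/-- A real-valued function is bounded. -/
def BddFun {X : Type*} (f : X → ℝ) : Prop := ∃ C, ∀ x, |f x| ≤ C

/-- `f ∈ DBSC(X)`: `f` is a difference of bounded lower semicontinuous functions. -/
def MemDBSC {X : Type*} [TopologicalSpace X] (f : X → ℝ) : Prop :=
  ∃ u v : X → ℝ, BddFun u ∧ BddFun v ∧ LowerSemicontinuous u ∧ LowerSemicontinuous v ∧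
    f = u - v

/-- The D-norm of `f`. -/
def DNorm {X : Type*} [TopologicalSpace X] (f : X → ℝ) : ℝ :=
  sInf {c | ∃ φ : ℕ → X → ℝ, (∀ j, Continuous (φ j)) ∧ (∀ x, Summable fun j => |φ j x|) ∧
    (∀ x, ∑' j, φ j x = f x) ∧ (∀ x, ∑' j, |φ j x| ≤ c)}

/-- The sup-norm of `f`. -/
def supNorm {X : Type*} (f : X → ℝ) : ℝ := ⨆ x, |f x|

/-- A simple D-function: a D-function taking finitely many values. -/
def SimpleD {X : Type*} [TopologicalSpace X] (f : X → ℝ) : Prop :=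
  MemDBSC f ∧ (Set.range f).Finite

/-- `f ∈ SD(X)`: `f` is a strong D-function. -/
def MemSD {X : Type*} [TopologicalSpace X] (f : X → ℝ) : Prop :=
  ∃ φ : ℕ → X → ℝ, (∀ n, SimpleD (φ n)) ∧
    Tendsto (fun n => DNorm (f - φ n)) atTop (𝓝 0)

/-- `f ∈ B_{1/2}(X)`: `f` is a uniform limit of D-functions. -/
def MemBHalf {X : Type*} [TopologicalSpace X] (f : X → ℝ) : Prop :=
  ∃ g : ℕ → X → ℝ, (∀ n, MemDBSC (g n)) ∧ TendstoUniformly g f atTop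

/-- The upper semicontinuous envelope `Uf`. -/
def uEnv {X : Type*} [TopologicalSpace X] (f : X → ℝ) (x : X) : ℝ :=
  sInf {c | ∃ V : Set X, IsOpen V ∧ x ∈ V ∧ sSup (f '' V) = c}

/-- The lower oscillation of `f` at `x`. -/
def losc {X : Type*} [TopologicalSpace X] (f : X → ℝ) (x : X) : ℝ :=
  sInf {c | ∃ V : Set X, IsOpen V ∧ x ∈ V ∧ sSup ((fun y => |f y - f x|) '' V) = c}

/-- The oscillation of `f`: `osc f = U (losc f)`. -/
def osc {X : Type*} [TopologicalSpace X] (f : X → ℝ) : X → ℝ := uEnv (losc f)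

/-- The oscillation sets `os_n(f, ε)`. -/
def osSet {X : Type*} [TopologicalSpace X] (f : X → ℝ) (ε : ℝ) : ℕ → Set X
  | 0 => Set.univ
  | n + 1 => {x | ∃ h : x ∈ osSet f ε n, ε ≤ osc ((osSet f ε n).restrict f) ⟨x, h⟩}

/-- The `ε`-oscillation index `i(f, ε) = sup {n : os_n(f,ε) ≠ ∅}`. -/
def oscIndex {X : Type*} [TopologicalSpace X] (f : X → ℝ) (ε : ℝ) : ℕ∞ :=
  ⨆ (m : ℕ) (_ : (osSet f ε m).Nonempty), (m : ℕ∞)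

/-- `f` has finite Baire index. -/
def FiniteBaireIndex {X : Type*} [TopologicalSpace X] (f : X → ℝ) : Prop :=
  ∃ n : ℕ, ∀ ε > 0, osSet f ε n = ∅

/-- The Baire index `i(f) = sup_{ε > 0} i(f, ε)`. -/
def baireIndex {X : Type*} [TopologicalSpace X] (f : X → ℝ) : ℕ∞ :=
  ⨆ (ε : ℝ) (_ : 0 < ε), oscIndex f ε

open scoped ENNReal

section Oscillation

variable {X : Type*} [TopologicalSpace X]

theorem le_uEnv_iff {φ : X → ℝ} (hφ : BddFun φ) (x : X) (c : ℝ) :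
    c ≤ uEnv φ x ↔ ∀ δ < c, ∃ᶠ y in 𝓝 x, δ < φ y := by
  obtain ⟨C, hC⟩ := hφ
  have hbdd : ∀ V : Set X, BddAbove (φ '' V) := by
    intro V
    refine ⟨C, ?_⟩
    rintro _ ⟨y, -, rfl⟩
    exact (abs_le.1 (hC y)).2
  constructor
  · intro h δ hδ hev
    obtain ⟨V, hV, hVo, hxV⟩ := eventually_nhds_iff.1 hev
    have h₁ : uEnv φ x ≤ sSup (φ '' V) := by
      refine csInf_le ⟨-C, ?_⟩ ⟨V, hVo, hxV, rfl⟩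
      rintro _ ⟨W, -, hxW, rfl⟩
      exact (abs_le.1 (hC x)).1.trans (le_csSup (hbdd W) ⟨x, hxW, rfl⟩)
    have h₂ : sSup (φ '' V) ≤ δ := by
      refine csSup_le ⟨φ x, x, hxV, rfl⟩ ?_
      rintro _ ⟨y, hy, rfl⟩
      exact not_lt.1 (hV y hy)
    linarith
  · intro h
    refine le_csInf ⟨_, univ, isOpen_univ, mem_univ x, rfl⟩ ?_
    rintro _ ⟨V, hVo, hxV, rfl⟩
    refine le_of_forall_lt fun δ hδ => ?_
    obtain ⟨y, hy, hyV⟩ := ((h δ hδ).and_eventually (hVo.mem_nhds hxV)).exists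
    exact hy.trans_le (le_csSup (hbdd V) ⟨y, hyV, rfl⟩)

theorem BddFun.abs_sub_const {X : Type*} {f : X → ℝ} (hf : BddFun f) (a : ℝ) :
    BddFun fun y => |f y - a| := by
  obtain ⟨C, hC⟩ := hf
  refine ⟨C + |a|, fun y => ?_⟩
  rw [abs_abs]
  exact (abs_sub _ _).trans (by linarith [hC y])

theorem le_losc_iff {f : X → ℝ} (hf : BddFun f) (x : X) (c : ℝ) :
    c ≤ losc f x ↔ ∀ δ < c, ∃ᶠ z in 𝓝 x, δ < |f z - f x| :=
  le_uEnv_iff (hf.abs_sub_const (f x)) x c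

theorem BddFun.losc {f : X → ℝ} (hf : BddFun f) : BddFun (losc f) := by
  obtain ⟨C, hC⟩ := id hf
  refine ⟨2 * C, fun x => abs_le.2 ⟨?_, ?_⟩⟩
  · have h₀ : 0 ≤ _root_.losc f x := (le_losc_iff hf x 0).2 fun δ hδ =>
      Frequently.of_forall fun z => hδ.trans_le (abs_nonneg _)
    linarith [(abs_nonneg _).trans (hC x)]
  · by_contra! hlt
    obtain ⟨z, hz⟩ := ((le_losc_iff hf x _).1 le_rfl _ hlt).exists
    linarith [abs_sub (f z) (f x), hC z, hC x]

theorem le_osc_iff {f : X → ℝ} (hf : BddFun f) (x : X) (c : ℝ) :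
    c ≤ osc f x ↔ ∀ δ < c, ∃ᶠ y in 𝓝 x, ∃ᶠ z in 𝓝 y, δ < |f z - f y| := by
  refine (le_uEnv_iff hf.losc x c).trans ⟨fun h δ hδ => ?_, fun h δ hδ => ?_⟩
  · exact (h δ hδ).mono fun y hy => (le_losc_iff hf y _).1 le_rfl δ hy
  · obtain ⟨δ', h₁, h₂⟩ := exists_between hδ
    refine (h δ' h₂).mono fun y hy => h₁.trans_le ?_
    exact (le_losc_iff hf y δ').2 fun η hη => hy.mono fun z hz => hη.trans hz

/-- The points of `L` at which the lower oscillation of `f` on `L` is at least `δ`, in the form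
that some points of `L` arbitrarily close have values more than `δ` away. -/
def jumpSet (f : X → ℝ) (δ : ℝ) (L : Set X) : Set X :=
  {y ∈ L | ∃ᶠ z in 𝓝[L] y, δ < |f z - f y|}

/-- The derivation whose iterates are the oscillation sets. -/
def oscDeriv (f : X → ℝ) (ε : ℝ) (L : Set X) : Set X :=
  ⋂ δ < ε, closure (jumpSet f δ L)

theorem jumpSet_mono (f : X → ℝ) (δ : ℝ) {A B : Set X} (h : A ⊆ B) :
    jumpSet f δ A ⊆ jumpSet f δ B :=
  fun _ hy => ⟨h hy.1, hy.2.filter_mono (nhdsWithin_mono _ h)⟩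

theorem jumpSet_antitone (f : X → ℝ) (L : Set X) : Antitone fun δ => jumpSet f δ L :=
  fun _ _ h _ hy => ⟨hy.1, hy.2.mono fun _ hz => h.trans_lt hz⟩

theorem jumpSet_union_subset (f : X → ℝ) (δ : ℝ) {A B : Set X} (hA : IsClosed A)
    (hB : IsClosed B) : jumpSet f δ (A ∪ B) ⊆ jumpSet f δ A ∪ jumpSet f δ B := by
  have key : ∀ {C : Set X}, IsClosed C → ∀ {y}, (∃ᶠ z in 𝓝[C] y, δ < |f z - f y|) →
      y ∈ jumpSet f δ C := fun {C} hC {y} hy => by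
    refine ⟨hC.mem_of_frequently_of_tendsto ?_ tendsto_id, hy⟩
    exact (frequently_nhdsWithin_iff.1 hy).mono fun z hz => hz.2
  rintro y ⟨-, hy⟩
  rw [nhdsWithin_union, frequently_sup] at hy
  exact hy.imp (key hA) (key hB)

theorem jumpSet_subset_union {f g h : X → ℝ}
    (hh : ∀ x y, |h x - h y| ≤ max |f x - f y| |g x - g y|) (δ : ℝ) (L : Set X) :
    jumpSet h δ L ⊆ jumpSet f δ L ∪ jumpSet g δ L := by
  rintro y ⟨hyL, hy⟩
  have hy' : ∃ᶠ z in 𝓝[L] y, δ < |f z - f y| ∨ δ < |g z - g y| :=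
    hy.mono fun z hz => lt_max_iff.1 (hz.trans_le (hh z y))
  exact (frequently_or_distrib.1 hy').imp (fun h => ⟨hyL, h⟩) fun h => ⟨hyL, h⟩

theorem iInter_closure_subset_union {ε : ℝ} {S A B : ℝ → Set X} (hA : Antitone A)
    (hB : Antitone B) (h : ∀ δ, S δ ⊆ A δ ∪ B δ) :
    ⋂ δ < ε, closure (S δ) ⊆ (⋂ δ < ε, closure (A δ)) ∪ ⋂ δ < ε, closure (B δ) := by
  intro x hx
  simp only [mem_union, mem_iInter] at hx ⊢
  by_contra! hcon
  obtain ⟨⟨δ₁, h₁, hx₁⟩, δ₂, h₂, hx₂⟩ := hcon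
  have hx' := closure_mono (h _) (hx (max δ₁ δ₂) (max_lt h₁ h₂))
  rw [closure_union] at hx'
  exact hx'.elim (fun h => hx₁ (closure_mono (hA (le_max_left _ _)) h))
    fun h => hx₂ (closure_mono (hB (le_max_right _ _)) h)

theorem isClosed_oscDeriv (f : X → ℝ) (ε : ℝ) (L : Set X) : IsClosed (oscDeriv f ε L) :=
  isClosed_biInter fun _ _ => isClosed_closure

theorem oscDeriv_mono (f : X → ℝ) (ε : ℝ) {A B : Set X} (h : A ⊆ B) :
    oscDeriv f ε A ⊆ oscDeriv f ε B :=
  iInter₂_mono fun δ _ => closure_mono (jumpSet_mono f δ h)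

theorem oscDeriv_subset (f : X → ℝ) (ε : ℝ) {L : Set X} (hL : IsClosed L) :
    oscDeriv f ε L ⊆ L := fun _ hx =>
  closure_minimal (sep_subset _ _) hL (mem_iInter₂.1 hx (ε - 1) (sub_one_lt ε))

theorem oscDeriv_union_subset (f : X → ℝ) (ε : ℝ) {A B : Set X} (hA : IsClosed A)
    (hB : IsClosed B) : oscDeriv f ε (A ∪ B) ⊆ oscDeriv f ε A ∪ oscDeriv f ε B :=
  iInter_closure_subset_union (jumpSet_antitone f A) (jumpSet_antitone f B)
    fun δ => jumpSet_union_subset f δ hA hB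

theorem oscDeriv_subset_union {f g h : X → ℝ}
    (hh : ∀ x y, |h x - h y| ≤ max |f x - f y| |g x - g y|) (ε : ℝ) (L : Set X) :
    oscDeriv h ε L ⊆ oscDeriv f ε L ∪ oscDeriv g ε L :=
  iInter_closure_subset_union (jumpSet_antitone f L) (jumpSet_antitone g L)
    fun δ => jumpSet_subset_union hh δ L

theorem oscDeriv_biUnion_subset {ι : Type*} (f : X → ℝ) (ε : ℝ) (s : Finset ι) {L : ι → Set X}
    (hL : ∀ i ∈ s, IsClosed (L i)) :
    oscDeriv f ε (⋃ i ∈ s, L i) ⊆ ⋃ i ∈ s, oscDeriv f ε (L i) := by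
  classical
  induction s using Finset.induction_on with
  | empty => simpa using oscDeriv_subset f ε (isClosed_empty (X := X))
  | insert i s _ ih =>
    rw [Finset.set_biUnion_insert, Finset.set_biUnion_insert]
    have hs : ∀ j ∈ s, IsClosed (L j) := fun j hj => hL j (Finset.mem_insert_of_mem hj)
    exact (oscDeriv_union_subset f ε (hL i (Finset.mem_insert_self i s))
      (isClosed_biUnion_finset hs)).trans (union_subset_union_right _ (ih hs))

theorem le_osc_restrict_iff {f : X → ℝ} (hf : BddFun f) {L : Set X} {x : X} (hx : x ∈ L)
    (ε : ℝ) : ε ≤ osc (L.domRestrict f) ⟨x, hx⟩ ↔ x ∈ oscDeriv f ε L := by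
  have hf' : BddFun (L.domRestrict f) := hf.imp fun C hC y => hC y
  have hin : ∀ (y : L) (δ : ℝ), (∃ᶠ z in 𝓝 y, δ < |L.domRestrict f z - L.domRestrict f y|) ↔
      ∃ᶠ z in 𝓝[L] (y : X), δ < |f z - f y| := fun y δ => by
    rw [nhdsWithin_eq_map_subtype_coe y.2, frequently_map]; rfl
  simp only [le_osc_iff hf', oscDeriv, mem_iInter, hin]
  refine forall₂_congr fun δ _ => ?_
  rw [mem_closure_iff_frequently,
    ← frequently_map (m := ((↑) : L → X)) (P := fun y => ∃ᶠ z in 𝓝[L] y, δ < |f z - f y|),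
    ← nhdsWithin_eq_map_subtype_coe hx, frequently_nhdsWithin_iff]
  simp only [jumpSet, mem_ofPred_eq, and_comm]

theorem osSet_succ {f : X → ℝ} (hf : BddFun f) (ε : ℝ) (n : ℕ) :
    osSet f ε (n + 1) = osSet f ε n ∩ oscDeriv f ε (osSet f ε n) := by
  ext x
  simp only [osSet, mem_ofPred_eq, mem_inter_iff, ← exists_prop]
  exact exists_congr fun hx => le_osc_restrict_iff hf hx ε

theorem isClosed_osSet {f : X → ℝ} (hf : BddFun f) (ε : ℝ) : ∀ n, IsClosed (osSet f ε n)
  | 0 => isClosed_univ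
  | n + 1 => by
    rw [osSet_succ hf]
    exact (isClosed_osSet hf ε n).inter (isClosed_oscDeriv f ε _)

theorem oscDeriv_osSet_subset {f : X → ℝ} (hf : BddFun f) (ε : ℝ) (n : ℕ) :
    oscDeriv f ε (osSet f ε n) ⊆ osSet f ε (n + 1) := by
  rw [osSet_succ hf]
  exact subset_inter (oscDeriv_subset f ε (isClosed_osSet hf ε n)) subset_rfl

theorem osSet_subset_biUnion {f g h : X → ℝ} (hbf : BddFun f) (hbg : BddFun g) (hbh : BddFun h)
    (hh : ∀ x y, |h x - h y| ≤ max |f x - f y| |g x - g y|) (ε : ℝ) (n : ℕ) :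
    osSet h ε n ⊆ ⋃ p ∈ Finset.HasAntidiagonal.antidiagonal n, osSet f ε p.1 ∩ osSet g ε p.2 := by
  induction n with
  | zero => simp [osSet]
  | succ n ih =>
    intro x hx
    rw [osSet_succ hbh] at hx
    have hx' := oscDeriv_biUnion_subset h ε _
      (fun p _ => (isClosed_osSet hbf ε p.1).inter (isClosed_osSet hbg ε p.2))
      (oscDeriv_mono h ε ih hx.2)
    simp only [mem_iUnion, Finset.HasAntidiagonal.mem_antidiagonal, exists_prop] at hx' ⊢
    obtain ⟨⟨i, j⟩, hij, hx'⟩ := hx'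
    have hmem := oscDeriv_subset h ε
      ((isClosed_osSet hbf ε i).inter (isClosed_osSet hbg ε j)) hx'
    rcases oscDeriv_subset_union hh ε _ hx' with hf | hg
    · exact ⟨(i + 1, j), by dsimp only at hij ⊢; omega,
        oscDeriv_osSet_subset hbf ε i (oscDeriv_mono f ε inter_subset_left hf), hmem.2⟩
    · exact ⟨(i, j + 1), by dsimp only at hij ⊢; omega,
        hmem.1, oscDeriv_osSet_subset hbg ε j (oscDeriv_mono g ε inter_subset_right hg)⟩

theorem oscIndex_le_add {f g h : X → ℝ} (hbf : BddFun f) (hbg : BddFun g) (hbh : BddFun h)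
    (hh : ∀ x y, |h x - h y| ≤ max |f x - f y| |g x - g y|) (ε : ℝ) :
    oscIndex h ε ≤ oscIndex f ε + oscIndex g ε := by
  refine iSup₂_le fun n hn => ?_
  obtain ⟨x, hx⟩ := hn
  have hx' := osSet_subset_biUnion hbf hbg hbh hh ε n hx
  simp only [mem_iUnion, Finset.HasAntidiagonal.mem_antidiagonal, exists_prop] at hx'
  obtain ⟨⟨i, j⟩, rfl, hf, hg⟩ := hx'
  rw [Nat.cast_add]
  exact add_le_add (le_iSup₂ (f := fun (m : ℕ) (_ : (osSet f ε m).Nonempty) => (m : ℕ∞)) i ⟨x, hf⟩)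
    (le_iSup₂ (f := fun (m : ℕ) (_ : (osSet g ε m).Nonempty) => (m : ℕ∞)) j ⟨x, hg⟩)

end Oscillation

/-- **Theorem 2.8 (c).** `i(h, ε) ≤ i(f, ε) + i(g, ε)` where `h = f ∨ g` or
`h = f ∧ g`. -/
theorem oscIndex_max_min_le {K : Type*} [MetricSpace K]
    [TopologicalSpace.SeparableSpace K] (f g h : K → ℝ)
    (hbf : BddFun f) (hbg : BddFun g)
    (hf : MemBHalf f) (hg : MemBHalf g) (ε : ℝ) (hε : 0 < ε)
    (hh : h = (fun x => max (f x) (g x)) ∨ h = (fun x => min (f x) (g x))) :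
    oscIndex h ε ≤ oscIndex f ε + oscIndex g ε := by
  rcases hh with rfl | rfl
  · refine oscIndex_le_add hbf hbg ?_ (fun x y => abs_max_sub_max_le_max _ _ _ _) ε
    obtain ⟨C, hC⟩ := hbf
    obtain ⟨D, hD⟩ := hbg
    exact ⟨max C D, fun x => abs_max_le_max_abs_abs.trans (max_le_max (hC x) (hD x))⟩
  · refine oscIndex_le_add hbf hbg ?_ (fun x y => abs_min_sub_min_le_max _ _ _ _) ε
    obtain ⟨C, hC⟩ := hbf
    obtain ⟨D, hD⟩ := hbg
    exact ⟨max C D, fun x => abs_min_le_max_abs_abs.trans (max_le_max (hC x) (hD x))⟩
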